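/- Fix k ≥ 1. The function u(x,t) = Σ_{n=0}^∞ (f_k^{(n)}(t)/(2n)!) x^{2n} with f_k(t) = exp(-t^{-2k}) is a smooth solution of the heat equation u_t = u_{xx} on ℝ × (0,∞). -/

import Mathlib

open Set Filter Topology

/-- The general term of the heat series: the `n`-th derivative of `F`, restricted to the real axis,
times `x ^ (2 * n + j) / (2 * n + j)!`. -/
noncomputable def heatTerm (j : ℕ) (F : ℂ → ℂ) (n : ℕ) (p : ℝ × ℝ) : ℝ :=
  (iteratedDeriv n F (p.2 : ℂ)).re * (p.1 ^ (2 * n + j) / ((2 * n + j).factorial : ℝ))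

/-- The even (`j = 0`) and odd (`j = 1`) heat series with initial data `F` on the time axis. -/
noncomputable def heatSeries (j : ℕ) (F : ℂ → ℂ) (p : ℝ × ℝ) : ℝ :=
  ∑' n, heatTerm j F n p

lemma isOpen_re_pos : IsOpen {z : ℂ | 0 < z.re} :=
  isOpen_lt continuous_const Complex.continuous_re

lemma differentiableOn_iteratedDeriv_re_pos {F : ℂ → ℂ}
    (hF : DifferentiableOn ℂ F {z : ℂ | 0 < z.re}) (n : ℕ) :
    DifferentiableOn ℂ (iteratedDeriv n F) {z : ℂ | 0 < z.re} := by
  induction n with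
  | zero => simpa using hF
  | succ n ih =>
    rw [iteratedDeriv_succ]
    exact ih.deriv isOpen_re_pos

lemma hasDerivAt_re_iteratedDeriv {F : ℂ → ℂ}
    (hF : DifferentiableOn ℂ F {z : ℂ | 0 < z.re}) (n : ℕ) {t : ℝ} (ht : 0 < t) :
    HasDerivAt (fun s : ℝ => (iteratedDeriv n F (s : ℂ)).re)
      (iteratedDeriv (n + 1) F (t : ℂ)).re t := by
  have h : DifferentiableAt ℂ (iteratedDeriv n F) (t : ℂ) :=
    (differentiableOn_iteratedDeriv_re_pos hF n).differentiableAt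
      (isOpen_re_pos.mem_nhds (by simpa using ht))
  rw [iteratedDeriv_succ]
  exact h.hasDerivAt.real_of_complex

lemma iteratedDeriv_eq_re {F : ℂ → ℂ} (hF : DifferentiableOn ℂ F {z : ℂ | 0 < z.re})
    {f : ℝ → ℝ} (hf : ∀ s : ℝ, f s = (F s).re) (n : ℕ) :
    ∀ t : ℝ, 0 < t → iteratedDeriv n f t = (iteratedDeriv n F (t : ℂ)).re := by
  induction n with
  | zero => intro t _; simpa using hf t
  | succ n ih =>
    intro t ht
    rw [iteratedDeriv_succ]
    have h : iteratedDeriv n f =ᶠ[𝓝 t] fun s : ℝ => (iteratedDeriv n F (s : ℂ)).re := by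
      filter_upwards [Ioi_mem_nhds ht] with s hs using ih s hs
    rw [h.deriv_eq]
    exact (hasDerivAt_re_iteratedDeriv hF n ht).deriv

lemma hasDerivAt_pow_div_factorial (n : ℕ) (x : ℝ) :
    HasDerivAt (fun y : ℝ => y ^ (n + 1) / ((n + 1).factorial : ℝ))
      (x ^ n / (n.factorial : ℝ)) x := by
  refine ((hasDerivAt_pow (n + 1) x).div_const ((n + 1).factorial : ℝ)).congr_deriv ?_
  rw [Nat.factorial_succ, Nat.add_sub_cancel]
  push_cast
  field_simp

lemma hasFDerivAt_mul_prod {a b : ℝ → ℝ} {a' b' : ℝ} {p : ℝ × ℝ}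
    (ha : HasDerivAt a a' p.2) (hb : HasDerivAt b b' p.1) :
    HasFDerivAt (fun q : ℝ × ℝ => a q.2 * b q.1)
      ((a p.2 * b') • ContinuousLinearMap.fst ℝ ℝ ℝ
        + (a' * b p.1) • ContinuousLinearMap.snd ℝ ℝ ℝ) p := by
  have h1 := ha.comp_hasFDerivAt p (hasFDerivAt_snd (𝕜 := ℝ) (E := ℝ) (F := ℝ) (p := p))
  have h2 := hb.comp_hasFDerivAt p (hasFDerivAt_fst (𝕜 := ℝ) (E := ℝ) (F := ℝ) (p := p))
  refine (h1.mul h2).congr_fderiv ?_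
  ext <;> simp [mul_comm]

lemma exists_summable_bound_heatTerm {F : ℂ → ℂ}
    (hF : DifferentiableOn ℂ F {z : ℂ | 0 < z.re}) (j : ℕ) {p₀ : ℝ × ℝ} (hp₀ : 0 < p₀.2) :
    ∃ v : ℕ → ℝ, Summable v ∧
      ∀ n, ∀ p ∈ Metric.ball p₀ (p₀.2 / 2), ‖heatTerm j F n p‖ ≤ v n := by
  obtain ⟨r, hr⟩ : ∃ r, r = p₀.2 / 4 := ⟨_, rfl⟩
  have hr0 : 0 < r := by rw [hr]; positivity
  set K := Metric.closedBall (p₀.2 : ℂ) (3 * r)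
  have hK : K ⊆ {z : ℂ | 0 < z.re} := by
    intro z hz
    have h1 : |(z - p₀.2).re| ≤ 3 * r :=
      (Complex.abs_re_le_norm _).trans (by simpa [K, dist_eq_norm] using hz)
    have := (abs_le.1 h1).1
    simp at this ⊢
    linarith
  obtain ⟨C, hC⟩ := (isCompact_closedBall (p₀.2 : ℂ) (3 * r)).exists_bound_of_continuousOn
    (hF.continuousOn.mono hK)
  have hC0 : 0 ≤ C :=
    (norm_nonneg _).trans (hC _ (Metric.mem_closedBall_self (by positivity)))
  obtain ⟨X, hX⟩ : ∃ X, X = |p₀.1| + p₀.2 / 2 := ⟨_, rfl⟩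
  have hX0 : 0 ≤ X := by rw [hX]; positivity
  refine ⟨fun n => C * X ^ j * ((X ^ 2 / r) ^ n / (n.factorial : ℝ)),
    (Real.summable_pow_div_factorial _).mul_left _, ?_⟩
  rintro n ⟨x, t⟩ hp
  rw [Metric.mem_ball, Prod.dist_eq, max_lt_iff, Real.dist_eq, Real.dist_eq] at hp
  obtain ⟨hx, ht⟩ := hp
  simp only at hx ht
  have hxX : |x| ≤ X := by
    have := abs_sub_abs_le_abs_sub x p₀.1
    linarith
  have hball : Metric.closedBall (t : ℂ) r ⊆ K := by
    apply Metric.closedBall_subset_closedBall'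
    rw [dist_eq_norm, ← Complex.ofReal_sub, Complex.norm_real, Real.norm_eq_abs]
    linarith
  have hcauchy : ‖iteratedDeriv n F (t : ℂ)‖ ≤ n.factorial * C / r ^ n := by
    apply Complex.norm_iteratedDeriv_le_of_forall_mem_sphere_norm_le n hr0
    · apply DifferentiableOn.diffContOnCl
      rw [closure_ball _ hr0.ne']
      exact hF.mono (hball.trans hK)
    · intro z hz
      exact hC z (hball (Metric.sphere_subset_closedBall hz))
  have hfac : (n.factorial : ℝ) * n.factorial ≤ (2 * n + j).factorial := by
    have h1 : n.factorial * n.factorial ≤ (2 * n + j).factorial :=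
      (Nat.le_of_dvd (Nat.factorial_pos _) (Nat.factorial_mul_factorial_dvd_factorial_add n n)).trans
        (Nat.factorial_le (by omega))
    exact_mod_cast h1
  have hn : (0 : ℝ) < n.factorial := by positivity
  rw [heatTerm, norm_mul, norm_div, norm_pow, Real.norm_eq_abs, Real.norm_eq_abs, Real.norm_eq_abs,
    Nat.abs_cast]
  calc |(iteratedDeriv n F (t : ℂ)).re| * (|x| ^ (2 * n + j) / ((2 * n + j).factorial : ℝ))
      ≤ (n.factorial * C / r ^ n) * (X ^ (2 * n + j) / (n.factorial * n.factorial)) := by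
        gcongr
        exact (Complex.abs_re_le_norm _).trans hcauchy
    _ = C * X ^ j * ((X ^ 2 / r) ^ n / (n.factorial : ℝ)) := by
        rw [div_pow, pow_add, ← pow_mul]
        field_simp

lemma summable_heatTerm {F : ℂ → ℂ} (hF : DifferentiableOn ℂ F {z : ℂ | 0 < z.re}) (j : ℕ)
    {p : ℝ × ℝ} (hp : 0 < p.2) : Summable fun n => heatTerm j F n p := by
  obtain ⟨v, hv, hb⟩ := exists_summable_bound_heatTerm hF j hp
  exact hv.of_norm_bounded fun n => hb n p (Metric.mem_ball_self (by positivity))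

lemma snd_pos_of_mem_ball {p₀ p : ℝ × ℝ} (hp : p ∈ Metric.ball p₀ (p₀.2 / 2)) : 0 < p.2 := by
  rw [Metric.mem_ball, Prod.dist_eq, max_lt_iff, Real.dist_eq, Real.dist_eq] at hp
  have := (abs_lt.1 hp.2).1
  have := (abs_nonneg _).trans_lt hp.2
  linarith

/-- Termwise differentiation of the heat series, given termwise derivatives `A n` in the
space variable that are dominated locally. -/
lemma hasFDerivAt_heatSeries {F : ℂ → ℂ} (hF : DifferentiableOn ℂ F {z : ℂ | 0 < z.re}) (j : ℕ)
    {p₀ : ℝ × ℝ} (hp₀ : 0 < p₀.2) {A : ℕ → ℝ × ℝ → ℝ} {v : ℕ → ℝ} (hv : Summable v)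
    (hA : ∀ n, ∀ p ∈ Metric.ball p₀ (p₀.2 / 2), ‖A n p‖ ≤ v n)
    (hderiv : ∀ n, ∀ p : ℝ × ℝ, 0 < p.2 → HasFDerivAt (heatTerm j F n)
      (A n p • ContinuousLinearMap.fst ℝ ℝ ℝ
        + heatTerm j (deriv F) n p • ContinuousLinearMap.snd ℝ ℝ ℝ) p) :
    HasFDerivAt (heatSeries j F)
      ((∑' n, A n p₀) • ContinuousLinearMap.fst ℝ ℝ ℝ
        + heatSeries j (deriv F) p₀ • ContinuousLinearMap.snd ℝ ℝ ℝ) p₀ := by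
  have hF' := hF.deriv isOpen_re_pos
  obtain ⟨w, hw, hB⟩ := exists_summable_bound_heatTerm hF' j hp₀
  have hmem : p₀ ∈ Metric.ball p₀ (p₀.2 / 2) := Metric.mem_ball_self (by positivity)
  have hsA : Summable fun n => A n p₀ := hv.of_norm_bounded fun n => hA n p₀ hmem
  have key := hasFDerivAt_tsum_of_isPreconnected (hv.add hw) Metric.isOpen_ball
    (convex_ball p₀ (p₀.2 / 2)).isPreconnected
    (fun n p hp => hderiv n p (snd_pos_of_mem_ball hp)) (fun n p hp => ?_) hmem
    (summable_heatTerm hF j hp₀) hmem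
  · rwa [((hsA.hasSum.smul_const (ContinuousLinearMap.fst ℝ ℝ ℝ)).add
      ((summable_heatTerm hF' j hp₀).hasSum.smul_const
        (ContinuousLinearMap.snd ℝ ℝ ℝ))).tsum_eq] at key
  · refine (norm_add_le _ _).trans ?_
    rw [norm_smul, norm_smul]
    have h1 := mul_le_of_le_one_right (norm_nonneg (A n p)) (ContinuousLinearMap.norm_fst_le ℝ ℝ ℝ)
    have h2 := mul_le_of_le_one_right (norm_nonneg (heatTerm j (deriv F) n p))
      (ContinuousLinearMap.norm_snd_le ℝ ℝ ℝ)
    exact add_le_add (h1.trans (hA n p hp)) (h2.trans (hB n p hp))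

lemma hasFDerivAt_heatSeries_one {F : ℂ → ℂ} (hF : DifferentiableOn ℂ F {z : ℂ | 0 < z.re})
    {p : ℝ × ℝ} (hp : 0 < p.2) :
    HasFDerivAt (heatSeries 1 F)
      (heatSeries 0 F p • ContinuousLinearMap.fst ℝ ℝ ℝ
        + heatSeries 1 (deriv F) p • ContinuousLinearMap.snd ℝ ℝ ℝ) p := by
  obtain ⟨v, hv, hb⟩ := exists_summable_bound_heatTerm hF 0 hp
  refine hasFDerivAt_heatSeries hF 1 hp hv hb fun n q hq => ?_
  have h := hasFDerivAt_mul_prod (hasDerivAt_re_iteratedDeriv hF n hq)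
    (hasDerivAt_pow_div_factorial (2 * n) q.1)
  rw [iteratedDeriv_succ'] at h
  exact h

lemma hasFDerivAt_heatSeries_zero {F : ℂ → ℂ} (hF : DifferentiableOn ℂ F {z : ℂ | 0 < z.re})
    {p : ℝ × ℝ} (hp : 0 < p.2) :
    HasFDerivAt (heatSeries 0 F)
      (heatSeries 1 (deriv F) p • ContinuousLinearMap.fst ℝ ℝ ℝ
        + heatSeries 0 (deriv F) p • ContinuousLinearMap.snd ℝ ℝ ℝ) p := by
  have hF' := hF.deriv isOpen_re_pos
  obtain ⟨v, hv, hb⟩ := exists_summable_bound_heatTerm hF' 1 hp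
  let A : ℕ → ℝ × ℝ → ℝ := fun n q => Nat.casesOn n 0 fun m => heatTerm 1 (deriv F) m q
  let w : ℕ → ℝ := fun n => Nat.casesOn n 0 v
  have hw : Summable w := (summable_nat_add_iff 1).1 hv
  have hAw : ∀ n, ∀ q ∈ Metric.ball p (p.2 / 2), ‖A n q‖ ≤ w n := by
    rintro (_ | n) q hq
    · simp [A, w]
    · exact hb n q hq
  have hsum : ∑' n, A n p = heatSeries 1 (deriv F) p := by
    have hs : Summable fun n => A n p :=
      hw.of_norm_bounded fun n => hAw n p (Metric.mem_ball_self (by positivity))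
    rw [hs.tsum_eq_zero_add]
    exact zero_add _
  rw [← hsum]
  refine hasFDerivAt_heatSeries hF 0 hp hw hAw fun n q hq => ?_
  rcases n with _ | n
  · have h := hasFDerivAt_mul_prod (hasDerivAt_re_iteratedDeriv hF 0 hq)
      (hasDerivAt_const q.1 (1 : ℝ))
    rw [iteratedDeriv_succ'] at h
    convert h using 1
    · ext y; simp [heatTerm]
    · simp [heatTerm, A]
  · have h := hasFDerivAt_mul_prod (hasDerivAt_re_iteratedDeriv hF (n + 1) hq)
      (hasDerivAt_pow_div_factorial (2 * n + 1) q.1)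
    rw [iteratedDeriv_succ' (n := n + 1)] at h
    refine h.congr_fderiv ?_
    simp only [A, heatTerm, iteratedDeriv_succ' (n := n)]
    rfl

lemma contDiffOn_heatSeries (N : ℕ) :
    ∀ {F : ℂ → ℂ}, DifferentiableOn ℂ F {z : ℂ | 0 < z.re} →
      ContDiffOn ℝ N (heatSeries 0 F) (univ ×ˢ Ioi 0) ∧
      ContDiffOn ℝ N (heatSeries 1 F) (univ ×ˢ Ioi 0) := by
  have hopen : IsOpen ((univ : Set ℝ) ×ˢ Ioi (0 : ℝ)) := isOpen_univ.prod isOpen_Ioi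
  induction N with
  | zero =>
    intro F hF
    simp only [Nat.cast_zero, contDiffOn_zero]
    exact ⟨fun p hp => (hasFDerivAt_heatSeries_zero hF hp.2).continuousAt.continuousWithinAt,
      fun p hp => (hasFDerivAt_heatSeries_one hF hp.2).continuousAt.continuousWithinAt⟩
  | succ N ih =>
    intro F hF
    have hF' := hF.deriv isOpen_re_pos
    rw [Nat.cast_succ, contDiffOn_succ_iff_hasFDerivWithinAt_of_uniqueDiffOn hopen.uniqueDiffOn,
      contDiffOn_succ_iff_hasFDerivWithinAt_of_uniqueDiffOn hopen.uniqueDiffOn]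
    exact ⟨⟨by simp, _, ((ih hF').2.smul contDiffOn_const).add ((ih hF').1.smul contDiffOn_const),
        fun p hp => (hasFDerivAt_heatSeries_zero hF hp.2).hasFDerivWithinAt⟩,
      ⟨by simp, _, ((ih hF).1.smul contDiffOn_const).add ((ih hF').2.smul contDiffOn_const),
        fun p hp => (hasFDerivAt_heatSeries_one hF hp.2).hasFDerivWithinAt⟩⟩

lemma hasDerivAt_partial_fst {g : ℝ × ℝ → ℝ} {a b x t : ℝ}
    (h : HasFDerivAt g (a • ContinuousLinearMap.fst ℝ ℝ ℝ
      + b • ContinuousLinearMap.snd ℝ ℝ ℝ) (x, t)) :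
    HasDerivAt (fun y => g (y, t)) a x := by
  exact (h.comp_hasDerivAt x ((hasDerivAt_id x).prodMk (hasDerivAt_const x t))).congr_deriv (by simp)

lemma hasDerivAt_partial_snd {g : ℝ × ℝ → ℝ} {a b x t : ℝ}
    (h : HasFDerivAt g (a • ContinuousLinearMap.fst ℝ ℝ ℝ
      + b • ContinuousLinearMap.snd ℝ ℝ ℝ) (x, t)) :
    HasDerivAt (fun s => g (x, s)) b t := by
  exact (h.comp_hasDerivAt t ((hasDerivAt_const t x).prodMk (hasDerivAt_id t))).congr_deriv (by simp)

theorem tychonoff_solution_solves_heat (k : ℕ) (hk : 1 ≤ k) :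
    ∀ u : ℝ → ℝ → ℝ,
      (u = fun x t => ∑' n : ℕ,
        iteratedDeriv n (fun s : ℝ => Real.exp (-1 / s ^ (2 * k))) t
          / ((2 * n).factorial : ℝ) * x ^ (2 * n)) →
      ContDiffOn ℝ (⊤ : ℕ∞) (fun p : ℝ × ℝ => u p.1 p.2) (Set.univ ×ˢ Set.Ioi 0) ∧
      ∀ x t : ℝ, 0 < t →
        deriv (fun s => u x s) t = deriv (deriv (fun y => u y t)) x := by
  rintro u rfl
  let F : ℂ → ℂ := fun z => Complex.exp (-1 / z ^ (2 * k))
  have hF : DifferentiableOn ℂ F {z : ℂ | 0 < z.re} := by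
    intro z hz
    have hz0 : z ≠ 0 := by
      rintro rfl
      simp at hz
    have h : DifferentiableAt ℂ (fun w : ℂ => -1 / w ^ (2 * k)) z := by
      fun_prop (disch := exact pow_ne_zero _ hz0)
    exact h.cexp.differentiableWithinAt
  have hF' := hF.deriv isOpen_re_pos
  have hf : ∀ s : ℝ, Real.exp (-1 / s ^ (2 * k)) = (F s).re := by
    intro s
    rw [← Complex.exp_ofReal_re]
    simp [F]
  have hu : ∀ x t : ℝ, 0 < t → (∑' n : ℕ,
      iteratedDeriv n (fun s : ℝ => Real.exp (-1 / s ^ (2 * k))) t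
        / ((2 * n).factorial : ℝ) * x ^ (2 * n)) = heatSeries 0 F (x, t) := by
    intro x t ht
    refine tsum_congr fun n => ?_
    rw [iteratedDeriv_eq_re hF hf n t ht, heatTerm, add_zero]
    ring
  refine ⟨?_, fun x t ht => ?_⟩
  · refine ContDiffOn.congr ?_ fun p hp => hu p.1 p.2 hp.2
    exact contDiffOn_infty.2 fun N => (contDiffOn_heatSeries N hF).1
  · have h1 : (fun s => ∑' n : ℕ,
        iteratedDeriv n (fun s : ℝ => Real.exp (-1 / s ^ (2 * k))) s
          / ((2 * n).factorial : ℝ) * x ^ (2 * n)) =ᶠ[𝓝 t] fun s => heatSeries 0 F (x, s) := by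
      filter_upwards [Ioi_mem_nhds ht] with s hs using hu x s hs
    have h2 : deriv (fun y => heatSeries 0 F (y, t)) = fun y => heatSeries 1 (deriv F) (y, t) :=
      funext fun y => (hasDerivAt_partial_fst (hasFDerivAt_heatSeries_zero hF (p := (y, t)) ht)).deriv
    simp only [hu _ t ht]
    rw [h1.deriv_eq, h2,
      (hasDerivAt_partial_snd (hasFDerivAt_heatSeries_zero hF (p := (x, t)) ht)).deriv,
      (hasDerivAt_partial_fst (hasFDerivAt_heatSeries_one hF' (p := (x, t)) ht)).deriv]
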